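/- For all integers g ≥ δ ≥ 0, the identity of formal power series ∑_{d=0}^∞ E(g,δ,d) · y^d = (1−y)^{2(g−δ)−2} · (1 − y + y^2)^δ holds in ℚ[[y]], where negative powers of (1−y) are interpreted via the inverse of the unit 1−y in ℚ[[y]]. (This is the algebraic content of the theorem identifying the generating function of Euler characteristics of Hilbert schemes of points on a δ-nodal genus-g curve with the Lefschetz trace on the cohomology of the compactified Jacobian divided by (y^{1/2}−y^{−1/2})^2.) -/

import Mathlib

open PowerSeries Finset

/-- Generalized binomial coefficient `C(a, k) = a(a-1)⋯(a-k+1)/k!` for an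
integer `a` and a natural number `k`, as a rational number. -/
def genChoose (a : ℤ) (k : ℕ) : ℚ :=
  (∏ j ∈ Finset.range k, ((a : ℚ) - j)) / (Nat.factorial k)

/-- `ǩ(λ) = δ₂ + δ₃ + ⋯ + δ_d`, the number of parts of `λ ⊢ d` that are at
least `2` (here `δ_ℓ` is the multiplicity of `ℓ` in `λ`). -/
def kcheck (d : ℕ) (lam : Nat.Partition d) : ℕ :=
  ∑ ℓ ∈ Finset.Icc 2 d, lam.parts.count ℓ

/-- `A_λ = ∏_{ℓ=2}^d (ℓ-1)^{δ_ℓ}` (equal to `1` when `d ≤ 1`). -/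
def Apart (d : ℕ) (lam : Nat.Partition d) : ℚ :=
  ∏ ℓ ∈ Finset.Icc 2 d, ((ℓ : ℚ) - 1) ^ (lam.parts.count ℓ)

/-- `E(g,δ,d) = ∑_{λ ⊢ d, ǩ(λ) ≤ δ} A_λ · δ!/((δ-ǩ(λ))! δ₂!⋯δ_d!) ·
C(δ₁+1+δ-ǩ(λ)-2g, δ₁)`, the Euler characteristic `χ(C^{[d]}_{g,δ})` of the
Hilbert scheme of `d` points on an integral `δ`-nodal curve of arithmetic
genus `g`. -/
def E (g δ d : ℕ) : ℚ :=
  ∑ lam : Nat.Partition d,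
    if kcheck d lam ≤ δ then
      Apart d lam *
        ((Nat.factorial δ : ℚ) /
          ((Nat.factorial (δ - kcheck d lam) : ℚ) *
            ∏ ℓ ∈ Finset.Icc 2 d, (Nat.factorial (lam.parts.count ℓ) : ℚ))) *
        genChoose ((lam.parts.count 1 : ℤ) + 1 + δ - kcheck d lam - 2 * g)
          (lam.parts.count 1)
    else 0

theorem genChoose_zero_right (a : ℤ) : genChoose a 0 = 1 := by simp [genChoose]

theorem genChoose_pascal (a : ℤ) (k : ℕ) :
    genChoose a (k + 1) = genChoose (a - 1) (k + 1) + genChoose (a - 1) k := by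
  have h : ∏ j ∈ Finset.range k, ((a : ℚ) - ((j + 1 : ℕ) : ℚ)) =
      ∏ j ∈ Finset.range k, (((a - 1 : ℤ) : ℚ) - j) :=
    Finset.prod_congr rfl fun j _ => by push_cast; ring
  have hk : (k.factorial : ℚ) ≠ 0 := by positivity
  have hk1 : ((k : ℚ) + 1) ≠ 0 := by positivity
  unfold genChoose
  rw [Finset.prod_range_succ', h, Finset.prod_range_succ, Nat.factorial_succ]
  push_cast
  field_simp
  ring

/-- The power series with coefficients `C(m + n, m)`, that is, `(1 - X) ^ (-(n + 1))`. -/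
def binomSeries (n : ℤ) : PowerSeries ℚ := PowerSeries.mk fun m => genChoose (m + n) m

theorem binomSeries_sub_one (n : ℤ) : binomSeries (n - 1) = binomSeries n * (1 - X) := by
  ext m
  rw [mul_sub, mul_one, map_sub]
  cases m with
  | zero => simp [binomSeries, genChoose_zero_right]
  | succ m =>
    rw [PowerSeries.coeff_succ_mul_X]
    simp only [binomSeries, PowerSeries.coeff_mk]
    rw [genChoose_pascal (((m + 1 : ℕ) : ℤ) + n), eq_sub_iff_add_eq]
    push_cast
    congr 2 <;> ring

theorem binomSeries_sub_natCast (n : ℤ) (j : ℕ) :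
    binomSeries (n - j) = binomSeries n * (1 - X) ^ j := by
  induction j with
  | zero => simp
  | succ j ih =>
    rw [pow_succ, ← mul_assoc, ← ih, ← binomSeries_sub_one]
    push_cast
    congr 1
    ring

theorem binomSeries_neg_one : binomSeries (-1) = 1 := by
  ext m
  cases m with
  | zero => simp [binomSeries, genChoose_zero_right]
  | succ m =>
    simp only [binomSeries, PowerSeries.coeff_mk, PowerSeries.coeff_one, genChoose]
    rw [Finset.prod_eq_zero (Finset.self_mem_range_succ m) (by push_cast; ring)]
    simp

theorem binomSeries_one : binomSeries 1 = ((1 - X)⁻¹ : PowerSeries ℚ) ^ 2 := by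
  have hu : (1 - X : PowerSeries ℚ) * (1 - X)⁻¹ = 1 :=
    PowerSeries.mul_inv_cancel _ (by simp)
  have h := binomSeries_sub_natCast 1 2
  norm_num [binomSeries_neg_one] at h
  calc binomSeries 1 = binomSeries 1 * ((1 - X) * (1 - X)⁻¹) ^ 2 := by rw [hu]; simp
    _ = (binomSeries 1 * (1 - X) ^ 2) * ((1 - X)⁻¹) ^ 2 := by ring
    _ = _ := by rw [← h, one_mul]

/-- The power series `∑ (ℓ - 1) X ^ ℓ`, summed over `ℓ ≥ 2`. -/
def weightSeries : PowerSeries ℚ := PowerSeries.mk fun l => ((l - 1 : ℕ) : ℚ)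

theorem weightSeries_mul : weightSeries * (1 - X) ^ 2 = X ^ 2 := by
  have h1 : weightSeries * (1 - X) = X * (X * PowerSeries.mk 1) := by
    ext m
    rw [mul_sub, mul_one, map_sub]
    rcases m with _ | _ | m
    · simp [weightSeries]
    · rw [PowerSeries.coeff_succ_mul_X]; simp [weightSeries, PowerSeries.coeff_succ_X_mul]
    · rw [PowerSeries.coeff_succ_mul_X]
      simp [weightSeries, PowerSeries.coeff_succ_X_mul]
  rw [pow_two, ← mul_assoc, h1, mul_assoc, mul_assoc, PowerSeries.mk_one_mul_one_sub_eq_one]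
  ring

theorem coeff_mul_weightSeries_pow (P : PowerSeries ℚ) (d k : ℕ) :
    PowerSeries.coeff d (P * weightSeries ^ k) = PowerSeries.coeff d
      (P * (∑ l ∈ Finset.Icc 2 d, PowerSeries.C ((l : ℚ) - 1) * X ^ l) ^ k) := by
  set T : PowerSeries ℚ := ∑ l ∈ Finset.Icc 2 d, PowerSeries.C ((l : ℚ) - 1) * X ^ l with hT
  have h : X ^ (d + 1) ∣ weightSeries - T := by
    rw [PowerSeries.X_pow_dvd_iff]
    intro m hm
    rw [map_sub, hT, map_sum]
    simp only [PowerSeries.coeff_C_mul, PowerSeries.coeff_X_pow, mul_ite, mul_one, mul_zero,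
      Finset.sum_ite_eq, weightSeries, PowerSeries.coeff_mk, Finset.mem_Icc]
    rcases m with _ | _ | m
    · simp
    · simp
    · rw [if_pos (by omega)]; push_cast [Nat.add_sub_cancel]; ring
  have h2 : X ^ (d + 1) ∣ P * weightSeries ^ k - P * T ^ k := by
    rw [← mul_sub]
    exact Dvd.dvd.mul_left (h.trans (sub_dvd_pow_sub_pow _ _ k)) P
  have := PowerSeries.X_pow_dvd_iff.1 h2 d (Nat.lt_succ_self d)
  rwa [map_sub, sub_eq_zero] at this

/-- The multiplicities of the parts of a partition that are at least `2`. -/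
def bigMult (d : ℕ) (lam : Nat.Partition d) (l : ℕ) : ℕ :=
  if l ∈ Finset.Icc 2 d then lam.parts.count l else 0

theorem count_one_add_sum_mul_count (d : ℕ) (lam : Nat.Partition d) :
    lam.parts.count 1 + ∑ l ∈ Finset.Icc 2 d, l * lam.parts.count l = d := by
  rcases Nat.eq_zero_or_pos d with rfl | hd
  · simp [Subsingleton.elim lam default]
  · have hsub : lam.parts.toFinset ⊆ Finset.Icc 1 d := by
      intro i hi
      rw [Multiset.mem_toFinset] at hi
      exact Finset.mem_Icc.2 ⟨lam.parts_pos hi, lam.parts_sum ▸ Multiset.le_sum_of_mem hi⟩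
    have h := Finset.sum_multiset_count_of_subset lam.parts _ hsub
    rw [lam.parts_sum, ← Finset.insert_Icc_add_one_left_eq_Icc hd,
      Finset.sum_insert (by simp)] at h
    simp only [smul_eq_mul, mul_one] at h
    refine Eq.trans ?_ h.symm
    exact congrArg _ (Finset.sum_congr rfl fun _ _ => mul_comm _ _)

/-- The partition of `d` with `a l` parts equal to `l` for `l ∈ [2, d]`, the remaining parts
being equal to `1`. -/
def partitionOfMult (d : ℕ) (a : ℕ → ℕ) (h : ∑ l ∈ Finset.Icc 2 d, l * a l ≤ d) :
    Nat.Partition d where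
  parts := Multiset.replicate (d - ∑ l ∈ Finset.Icc 2 d, l * a l) 1 +
    ∑ l ∈ Finset.Icc 2 d, Multiset.replicate (a l) l
  parts_pos := by
    intro i hi
    rw [Multiset.mem_add, Multiset.mem_sum] at hi
    rcases hi with hi | ⟨l, hl, hi⟩
    · rw [Multiset.eq_of_mem_replicate hi]; exact one_pos
    · rw [Multiset.eq_of_mem_replicate hi]
      have := (Finset.mem_Icc.1 hl).1
      omega
  parts_sum := by
    rw [Multiset.sum_add, Multiset.sum_sum]
    simp only [Multiset.sum_replicate, smul_eq_mul, mul_one, mul_comm (a _)]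
    omega

theorem count_partitionOfMult {d : ℕ} {a : ℕ → ℕ} (h : ∑ l ∈ Finset.Icc 2 d, l * a l ≤ d)
    {l : ℕ} (hl : l ∈ Finset.Icc 2 d) : (partitionOfMult d a h).parts.count l = a l := by
  have h1 : 1 ≠ l := by have := (Finset.mem_Icc.1 hl).1; omega
  simp only [partitionOfMult, Multiset.count_add, Multiset.count_sum', Multiset.count_replicate,
    Finset.sum_ite_eq', if_neg h1, if_pos hl, zero_add]

theorem bigMult_of_mem {d l : ℕ} (lam : Nat.Partition d) (hl : l ∈ Finset.Icc 2 d) :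
    bigMult d lam l = lam.parts.count l :=
  if_pos hl

theorem sum_mul_bigMult (d : ℕ) (lam : Nat.Partition d) :
    ∑ l ∈ Finset.Icc 2 d, l * bigMult d lam l = ∑ l ∈ Finset.Icc 2 d, l * lam.parts.count l :=
  Finset.sum_congr rfl fun _ hl => congrArg _ (bigMult_of_mem lam hl)

theorem bigMult_injective (d : ℕ) : Function.Injective (bigMult d) := by
  intro lam mu h
  have hbig : ∀ l ∈ Finset.Icc 2 d, lam.parts.count l = mu.parts.count l := by
    intro l hl
    simpa only [bigMult, if_pos hl] using congrFun h l
  have h1 := count_one_add_sum_mul_count d lam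
  rw [Finset.sum_congr rfl fun l hl => by rw [hbig l hl]] at h1
  have h2 := count_one_add_sum_mul_count d mu
  have hout : ∀ (nu : Nat.Partition d) (l : ℕ), l = 0 ∨ d < l → nu.parts.count l = 0 := by
    intro nu l hl
    refine Multiset.count_eq_zero.2 fun hmem => ?_
    have := nu.parts_pos hmem
    have := nu.parts_sum ▸ Multiset.le_sum_of_mem hmem
    omega
  refine Nat.Partition.ext (Multiset.ext.2 fun l => ?_)
  by_cases hl : l ∈ Finset.Icc 2 d
  · exact hbig l hl
  · by_cases hl1 : l = 1
    · subst hl1; omega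
    · rw [Finset.mem_Icc] at hl
      rw [hout lam l (by omega), hout mu l (by omega)]

theorem sum_partition_eq_sum_piAntidiag (d k : ℕ) (F : (ℕ → ℕ) → ℚ) :
    ∑ lam : Nat.Partition d with kcheck d lam = k, F (bigMult d lam) =
      ∑ a ∈ (Finset.Icc 2 d).piAntidiag k with ∑ l ∈ Finset.Icc 2 d, l * a l ≤ d, F a := by
  refine Finset.sum_bij (fun lam _ => bigMult d lam) ?_ ?_ ?_ fun _ _ => rfl
  · intro lam hlam
    rw [Finset.mem_filter] at hlam ⊢
    rw [Finset.mem_piAntidiag, Finset.sum_congr rfl fun l hl => bigMult_of_mem lam hl,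
      sum_mul_bigMult]
    refine ⟨⟨hlam.2, fun i hi => ?_⟩, ?_⟩
    · by_contra hn
      exact hi (if_neg hn)
    · have := count_one_add_sum_mul_count d lam
      omega
  · exact fun _ _ _ _ h => bigMult_injective d h
  · intro a ha
    rw [Finset.mem_filter, Finset.mem_piAntidiag] at ha
    obtain ⟨⟨hsum, hsupp⟩, hle⟩ := ha
    refine ⟨partitionOfMult d a hle, ?_, ?_⟩
    · rw [Finset.mem_filter]
      refine ⟨Finset.mem_univ _, ?_⟩
      rw [kcheck, Finset.sum_congr rfl fun l hl => count_partitionOfMult hle hl]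
      exact hsum
    · funext l
      by_cases hl : l ∈ Finset.Icc 2 d
      · rw [bigMult_of_mem _ hl, count_partitionOfMult hle hl]
      · rw [bigMult, if_neg hl]
        by_contra hn
        exact hl (hsupp l (Ne.symm hn))

theorem coeff_binomSeries_mul_pow (n : ℤ) (d k : ℕ) :
    PowerSeries.coeff d (binomSeries n * weightSeries ^ k) =
      ∑ lam : Nat.Partition d with kcheck d lam = k,
        Apart d lam * ((k.factorial : ℚ) /
          ∏ l ∈ Finset.Icc 2 d, ((lam.parts.count l).factorial : ℚ)) *
          genChoose (lam.parts.count 1 + n) (lam.parts.count 1) := by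
  let F : (ℕ → ℕ) → ℚ := fun a =>
    (∏ l ∈ Finset.Icc 2 d, ((l : ℚ) - 1) ^ a l) *
      ((k.factorial : ℚ) / ∏ l ∈ Finset.Icc 2 d, ((a l).factorial : ℚ)) *
      genChoose ((d - ∑ l ∈ Finset.Icc 2 d, l * a l : ℕ) + n) (d - ∑ l ∈ Finset.Icc 2 d, l * a l)
  have hF : ∀ lam : Nat.Partition d, Apart d lam * ((k.factorial : ℚ) /
      ∏ l ∈ Finset.Icc 2 d, ((lam.parts.count l).factorial : ℚ)) *
      genChoose (lam.parts.count 1 + n) (lam.parts.count 1) = F (bigMult d lam) := by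
    intro lam
    have hone : d - ∑ l ∈ Finset.Icc 2 d, l * bigMult d lam l = lam.parts.count 1 := by
      rw [sum_mul_bigMult]
      have := count_one_add_sum_mul_count d lam
      omega
    have hpow : ∏ l ∈ Finset.Icc 2 d, ((l : ℚ) - 1) ^ bigMult d lam l = Apart d lam :=
      Finset.prod_congr rfl fun l hl => by rw [bigMult_of_mem lam hl]
    have hfac : ∏ l ∈ Finset.Icc 2 d, ((bigMult d lam l).factorial : ℚ) =
        ∏ l ∈ Finset.Icc 2 d, ((lam.parts.count l).factorial : ℚ) :=
      Finset.prod_congr rfl fun l hl => by rw [bigMult_of_mem lam hl]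
    simp only [F, hone, hpow, hfac]
  simp only [hF]
  rw [sum_partition_eq_sum_piAntidiag, coeff_mul_weightSeries_pow,
    Finset.sum_pow_eq_sum_piAntidiag, Finset.mul_sum, map_sum, Finset.sum_filter]
  refine Finset.sum_congr rfl fun a ha => ?_
  have hterm : binomSeries n * ((Nat.multinomial (Finset.Icc 2 d) a : PowerSeries ℚ) *
      ∏ l ∈ Finset.Icc 2 d, (PowerSeries.C ((l : ℚ) - 1) * X ^ l) ^ a l) =
      PowerSeries.C ((Nat.multinomial (Finset.Icc 2 d) a : ℚ) *
        ∏ l ∈ Finset.Icc 2 d, ((l : ℚ) - 1) ^ a l) *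
        (binomSeries n * X ^ ∑ l ∈ Finset.Icc 2 d, l * a l) := by
    simp only [mul_pow, Finset.prod_mul_distrib, ← pow_mul, Finset.prod_pow_eq_pow_sum,
      map_mul, map_prod, map_pow, map_natCast]
    ring
  have hmult : (Nat.multinomial (Finset.Icc 2 d) a : ℚ) =
      (k.factorial : ℚ) / ∏ l ∈ Finset.Icc 2 d, ((a l).factorial : ℚ) := by
    rw [eq_div_iff (Finset.prod_ne_zero_iff.2 fun l _ => by positivity), mul_comm,
      ← (Finset.mem_piAntidiag.1 ha).1, ← Nat.multinomial_spec]
    push_cast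
    rfl
  rw [hterm, PowerSeries.coeff_C_mul, PowerSeries.coeff_mul_X_pow', mul_ite, mul_zero, hmult]
  simp only [F, binomSeries, PowerSeries.coeff_mk]
  split_ifs
  · ring
  · rfl

theorem E_eq_sum_coeff (g δ d : ℕ) :
    E g δ d = ∑ k ∈ Finset.range (δ + 1), (δ.choose k : ℚ) *
      PowerSeries.coeff d (binomSeries (1 + δ - k - 2 * g) * weightSeries ^ k) := by
  rw [E, ← Finset.sum_filter, ← Finset.sum_fiberwise_of_maps_to (t := Finset.range (δ + 1))
    (g := kcheck d) fun lam hlam => by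
      rw [Finset.mem_filter] at hlam
      exact Finset.mem_range_succ_iff.2 hlam.2]
  refine Finset.sum_congr rfl fun k hk => ?_
  have hk' : k ≤ δ := Finset.mem_range_succ_iff.1 hk
  rw [coeff_binomSeries_mul_pow, Finset.mul_sum, Finset.filter_filter]
  refine Finset.sum_congr ?_ fun lam hlam => ?_
  · ext lam
    simp only [Finset.mem_filter, Finset.mem_univ, true_and]
    omega
  · rw [(Finset.mem_filter.1 hlam).2, Nat.cast_choose ℚ hk']
    have hfac : ∀ m : ℕ, (m.factorial : ℚ) ≠ 0 := fun m => by positivity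
    have hp : ∏ l ∈ Finset.Icc 2 d, ((lam.parts.count l).factorial : ℚ) ≠ 0 :=
      Finset.prod_ne_zero_iff.2 fun l _ => hfac _
    have harg : (lam.parts.count 1 : ℤ) + 1 + δ - k - 2 * g =
        lam.parts.count 1 + (1 + δ - k - 2 * g) := by ring
    rw [harg]
    have := hfac k
    have := hfac (δ - k)
    field_simp

/-- For `g ≥ δ ≥ 0`,
`∑_{d≥0} E(g,δ,d) y^d = (1-y)^{2(g-δ)-2} (1 - y + y²)^δ` in `ℚ[[y]]`. -/
theorem stmt_11 (g δ : ℕ) (hδg : δ ≤ g) :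
    PowerSeries.mk (fun d => E g δ d) =
      (1 - PowerSeries.X : PowerSeries ℚ) ^ (2 * (g - δ)) *
        ((1 - PowerSeries.X)⁻¹ : PowerSeries ℚ) ^ 2 *
        (1 - PowerSeries.X + PowerSeries.X ^ 2) ^ δ := by
  have hmk : PowerSeries.mk (fun d => E g δ d) = ∑ k ∈ Finset.range (δ + 1),
      PowerSeries.C (δ.choose k : ℚ) *
        (binomSeries (1 + δ - k - 2 * g) * weightSeries ^ k) := by
    ext d
    simp only [PowerSeries.coeff_mk, map_sum, PowerSeries.coeff_C_mul, E_eq_sum_coeff]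
  have hbinom : ∀ k : ℕ, binomSeries (1 + δ - k - 2 * g) =
      ((1 - X)⁻¹ : PowerSeries ℚ) ^ 2 * (1 - X) ^ (2 * (g - δ) + δ + k) := by
    intro k
    rw [← binomSeries_one, ← binomSeries_sub_natCast]
    congr 1
    push_cast [hδg]
    ring
  have hbase : (1 - X + X ^ 2 : PowerSeries ℚ) =
      (1 - X) * ((1 - X) * weightSeries + 1) := by
    rw [← weightSeries_mul]
    ring
  rw [hmk, hbase, mul_pow, add_pow, Finset.mul_sum, Finset.mul_sum]
  refine Finset.sum_congr rfl fun k _ => ?_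
  rw [hbinom, map_natCast, mul_pow _ weightSeries, one_pow]
  ring
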